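/- Let X and Y be finite-dimensional subspaces of a complex Hilbert space H. Then there exist m, p, q, d ∈ ℕ ∪ {0}, angles φ_1, …, φ_d ∈ (0, π/2), and an orthonormal basis B of X + Y such that the matrix of P_X restricted to X + Y with respect to B equals I_m ⊕ I_p ⊕ 0_q ⊕ ⊕_{j=1}^d [[1, 0],[0, 0]], and the matrix of P_Y restricted to X + Y with respect to B equals I_m ⊕ 0_p ⊕ I_q ⊕ ⊕_{j=1}^d [[cos²φ_j, cos φ_j sin φ_j],[cos φ_j sin φ_j, sin²φ_j]]. -/

import Mathlib

noncomputable section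

/-- The trace of a finite-rank bounded operator, computed as the trace of its
restriction to its (invariant) range. -/
def opTrace {H : Type*} [NormedAddCommGroup H] [InnerProductSpace ℂ H]
    (T : H →L[ℂ] H) : ℂ :=
  LinearMap.trace ℂ (LinearMap.range (T : H →ₗ[ℂ] H))
    ((T : H →ₗ[ℂ] H).restrict (p := LinearMap.range (T : H →ₗ[ℂ] H))
      (q := LinearMap.range (T : H →ₗ[ℂ] H))
      (fun x _ => LinearMap.mem_range_self _ x))

/-- A bounded operator has finite rank if its range is finite-dimensional. -/
def FinRk {H : Type*} [NormedAddCommGroup H] [InnerProductSpace ℂ H]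
    (T : H →L[ℂ] H) : Prop :=
  FiniteDimensional ℂ (LinearMap.range (T : H →ₗ[ℂ] H))

/-- `IsProjFR T` means that `T` is a finite-rank projection:
a self-adjoint idempotent bounded operator with finite-dimensional range. -/
def IsProjFR {H : Type*} [NormedAddCommGroup H] [InnerProductSpace ℂ H] [CompleteSpace H]
    (T : H →L[ℂ] H) : Prop :=
  IsSelfAdjoint T ∧ T ∘L T = T ∧ FinRk T

/-- `IsProjR T k` means that `T` is a projection of rank `k`. -/
def IsProjR {H : Type*} [NormedAddCommGroup H] [InnerProductSpace ℂ H] [CompleteSpace H]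
    (T : H →L[ℂ] H) (k : ℕ) : Prop :=
  IsProjFR T ∧ Module.finrank ℂ (LinearMap.range (T : H →ₗ[ℂ] H)) = k

/-- The real vector space `F_s(H)` of finite-rank bounded self-adjoint operators on `H`. -/
def FsS (H : Type*) [NormedAddCommGroup H] [InnerProductSpace ℂ H] [CompleteSpace H] :
    Submodule ℝ (H →L[ℂ] H) where
  carrier := {T | IsSelfAdjoint T ∧ FinRk T}
  add_mem' := by
    rintro S T ⟨hS, hSf⟩ ⟨hT, hTf⟩
    refine ⟨hS.add hT, ?_⟩
    haveI : FiniteDimensional ℂ (LinearMap.range (S : H →ₗ[ℂ] H)) := hSf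
    haveI : FiniteDimensional ℂ (LinearMap.range (T : H →ₗ[ℂ] H)) := hTf
    have hle : LinearMap.range ((S + T : H →L[ℂ] H) : H →ₗ[ℂ] H) ≤
        LinearMap.range (S : H →ₗ[ℂ] H) ⊔ LinearMap.range (T : H →ₗ[ℂ] H) := by
      rintro x ⟨y, rfl⟩
      exact Submodule.add_mem_sup (LinearMap.mem_range_self _ y) (LinearMap.mem_range_self _ y)
    exact Submodule.finiteDimensional_of_le hle
  zero_mem' := by
    refine ⟨(IsSelfAdjoint.zero _), ?_⟩
    have : LinearMap.range ((0 : H →L[ℂ] H) : H →ₗ[ℂ] H) = ⊥ := LinearMap.range_eq_bot.2 rfl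
    rw [FinRk, this]
    infer_instance
  smul_mem' := by
    rintro r T ⟨hT, hTf⟩
    refine ⟨(IsSelfAdjoint.all r).smul hT, ?_⟩
    haveI : FiniteDimensional ℂ (LinearMap.range (T : H →ₗ[ℂ] H)) := hTf
    have hle : LinearMap.range ((r • T : H →L[ℂ] H) : H →ₗ[ℂ] H) ≤
        LinearMap.range (T : H →ₗ[ℂ] H) := by
      rintro x ⟨y, rfl⟩
      show (r • T) y ∈ _
      rw [ContinuousLinearMap.smul_apply]
      exact Submodule.smul_of_tower_mem _ r (LinearMap.mem_range_self _ y)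
    exact Submodule.finiteDimensional_of_le hle

/-- The real vector space `S(H)` of bounded self-adjoint operators on `H`. -/
def SaS (H : Type*) [NormedAddCommGroup H] [InnerProductSpace ℂ H] [CompleteSpace H] :
    Submodule ℝ (H →L[ℂ] H) where
  carrier := {T | IsSelfAdjoint T}
  add_mem' := fun hS hT => hS.add hT
  zero_mem' := (IsSelfAdjoint.zero _)
  smul_mem' := fun r _T hT => (IsSelfAdjoint.all r).smul hT

/-- `IsConjBy U A B` expresses that `B = U A U*` for an isometry `U` (linear or
conjugate-linear): `B` agrees with `U ∘ A` on the image of `U` and vanishes on its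
orthogonal complement. -/
def IsConjBy {H K : Type*} [NormedAddCommGroup H] [InnerProductSpace ℂ H]
    [NormedAddCommGroup K] [InnerProductSpace ℂ K]
    (U : H → K) (A : H →L[ℂ] H) (B : K →L[ℂ] K) : Prop :=
  (∀ x : H, B (U x) = U (A x)) ∧
  ∀ y : K, (∀ x : H, (inner ℂ (U x) y : ℂ) = 0) → B y = 0

/-- The orthogonal projection onto a subspace, as an operator `H →L[ℂ] H`
(defined to be `0` if the subspace is not finite-dimensional). -/
def Pj {H : Type*} [NormedAddCommGroup H] [InnerProductSpace ℂ H]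
    (X : Submodule ℂ H) : H →L[ℂ] H := by
  classical
  exact if h : FiniteDimensional ℂ X then
    haveI := h
    haveI : CompleteSpace X := FiniteDimensional.complete ℂ X
    X.subtypeL ∘L Submodule.orthogonalProjectionOnto X
  else 0

/-- The set `H_a(X, Y)` of all finite-dimensional subspaces `Z` such that
`a(P_X + P_Y) + (1 - 2a) P_Z` is a projection. -/
def Hol {H : Type*} [NormedAddCommGroup H] [InnerProductSpace ℂ H] [CompleteSpace H]
    (a : ℝ) (X Y : Submodule ℂ H) : Set (Submodule ℂ H) :=
  {Z | FiniteDimensional ℂ Z ∧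
    IsSelfAdjoint (a • (Pj X + Pj Y) + (1 - 2*a) • Pj Z) ∧
    (a • (Pj X + Pj Y) + (1 - 2*a) • Pj Z) ∘L (a • (Pj X + Pj Y) + (1 - 2*a) • Pj Z) =
      a • (Pj X + Pj Y) + (1 - 2*a) • Pj Z}

/-- The matrix of an operator `T` with respect to an orthonormal basis `b` of a
(`T`-invariant) finite-dimensional subspace `Z`. -/
def matOf {H : Type*} [NormedAddCommGroup H] [InnerProductSpace ℂ H]
    {Z : Submodule ℂ H} {N : ℕ} (b : OrthonormalBasis (Fin N) ℂ Z) (T : H →L[ℂ] H) :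
    Matrix (Fin N) (Fin N) ℂ :=
  Matrix.of fun i j => (inner ℂ ((b i : H)) (T (b j : H)) : ℂ)

/-- Restriction of a bounded operator to an invariant subspace. -/
def clmRestrict {H : Type*} [NormedAddCommGroup H] [InnerProductSpace ℂ H]
    (T : H →L[ℂ] H) (M : Submodule ℂ H) (h : ∀ x ∈ M, T x ∈ M) : M →L[ℂ] M :=
  ContinuousLinearMap.codRestrict (T ∘L M.subtypeL) M (fun x => h x x.2)

end


open Matrix Kronecker

/-- `Mat m` is the space of `m × m` complex matrices. -/
abbrev Mat (m : ℕ) : Type := Matrix (Fin m) (Fin m) ℂ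

/-- The "real part" `(A + A*)/2` of a square complex matrix. -/
noncomputable def MRe {m : ℕ} (A : Mat m) : Mat m := (2⁻¹ : ℂ) • (A + Aᴴ)

/-- The real vector space `ℋ_m` of `m × m` complex hermitian matrices,
as a real submodule of `Mat m`. -/
noncomputable def HermS (m : ℕ) : Submodule ℝ (Mat m) where
  carrier := {A | A.IsHermitian}
  add_mem' := fun ha hb => ha.add hb
  zero_mem' := Matrix.isHermitian_zero
  smul_mem' := fun r A hA => by
    simpa [Matrix.IsHermitian, Matrix.conjTranspose_smul] using congrArg (r • ·) hA

/-- The real vector space `ℋ_m^0` of trace-zero `m × m` complex hermitian matrices,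
as a real submodule of `Mat m`. -/
noncomputable def H0S (m : ℕ) : Submodule ℝ (Mat m) where
  carrier := {A | A.IsHermitian ∧ A.trace = 0}
  add_mem' := fun ha hb => ⟨ha.1.add hb.1, by simp [Matrix.trace_add, ha.2, hb.2]⟩
  zero_mem' := ⟨Matrix.isHermitian_zero, by simp⟩
  smul_mem' := fun r A hA => ⟨by
    simpa [Matrix.IsHermitian, Matrix.conjTranspose_smul] using congrArg (r • ·) hA.1,
    by simp [Matrix.trace_smul, hA.2]⟩

/-- Transport a square matrix along an equality of sizes. -/
def castM {a b : ℕ} (h : a = b) (A : Mat a) : Mat b :=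
  Matrix.reindex (finCongr h) (finCongr h) A

/-- A `2 × 2` block matrix with blocks of sizes `a` and `b`. -/
def blks {a b : ℕ} (A : Matrix (Fin a) (Fin a) ℂ) (B : Matrix (Fin a) (Fin b) ℂ)
    (C : Matrix (Fin b) (Fin a) ℂ) (D : Matrix (Fin b) (Fin b) ℂ) : Mat (a + b) :=
  Matrix.reindex finSumFinEquiv finSumFinEquiv (Matrix.fromBlocks A B C D)

/-- The direct (block-diagonal) sum `A ⊕ B` of square matrices. -/
def dsum {a b : ℕ} (A : Mat a) (B : Mat b) : Mat (a + b) := blks A 0 0 B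

/-- The Kronecker product of complex matrices, with `Fin`-indexing. -/
def kron {a b c d : ℕ} (A : Matrix (Fin a) (Fin b) ℂ) (B : Matrix (Fin c) (Fin d) ℂ) :
    Matrix (Fin (a * c)) (Fin (b * d)) ℂ :=
  Matrix.reindex finProdFinEquiv finProdFinEquiv (A ⊗ₖ B)

/-- Iterated direct (block-diagonal) sum `A 0 ⊕ A 1 ⊕ ⋯ ⊕ A (r-1)` of square matrices
of sizes `m 0, …, m (r-1)`. -/
def bdiag : {r : ℕ} → (m : Fin r → ℕ) → ((j : Fin r) → Mat (m j)) → Mat (∑ j, m j)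
  | 0, _, _ => 0
  | _+1, m, A =>
      castM (Fin.sum_univ_succ m).symm
        (dsum (A 0) (bdiag (fun j => m j.succ) (fun j => A j.succ)))



theorem bdiag_two_eq (d : ℕ) : ∃ e : Fin d × Fin 2 ≃ Fin (∑ _j : Fin d, 2),
    ∀ A : Fin d → Mat 2, ∀ x y, bdiag (fun _ => 2) A (e x) (e y) =
      if x.1 = y.1 then A x.1 x.2 y.2 else 0 := by
  induction d with
  | zero => 
    have : IsEmpty (Fin (∑ _j : Fin 0, 2)) := by
      simp only [Finset.univ_eq_empty, Finset.sum_empty]; infer_instance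
    exact ⟨Equiv.equivOfIsEmpty _ _, fun A x => x.1.elim0⟩
  | succ d ih =>
    obtain ⟨e, he⟩ := ih
    let e1 : Fin (d+1) × Fin 2 ≃ Fin 2 ⊕ (Fin d × Fin 2) :=
      { toFun := fun x => Fin.cases (motive := fun _ => Fin 2 ⊕ (Fin d × Fin 2))
          (Sum.inl x.2) (fun i => Sum.inr (i, x.2)) x.1
        invFun := Sum.elim (fun k => (0, k)) (fun z => (z.1.succ, z.2))
        left_inv := by
          rintro ⟨i, k⟩
          refine Fin.cases ?_ (fun i => ?_) i <;> simp
        right_inv := by rintro (k | ⟨i, k⟩) <;> simp }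
    refine ⟨((e1.trans (Equiv.sumCongr (Equiv.refl _) e)).trans finSumFinEquiv).trans
      (finCongr (Fin.sum_univ_succ (fun _ : Fin (d+1) => 2)).symm), ?_⟩
    rintro A ⟨i, k⟩ ⟨j, l⟩
    refine Fin.cases ?_ (fun i => ?_) i <;> refine Fin.cases ?_ (fun j => ?_) j <;>
      simp [bdiag, castM, dsum, blks, e1, he, Fin.succ_ne_zero, (Fin.succ_ne_zero _).symm]

theorem assemble {H : Type*} [NormedAddCommGroup H] [InnerProductSpace ℂ H]
    {Z : Submodule ℂ H} (P Q : H →L[ℂ] H) {A B C D : Type} [Fintype A] [Fintype B] [Fintype C]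
    [Fintype D] (t : D → ℝ) (ht : ∀ j, 0 < t j ∧ t j < Real.pi / 2)
    (b : OrthonormalBasis (((A ⊕ B) ⊕ C) ⊕ (D × Fin 2)) ℂ Z)
    (hPA : ∀ i, P (b (.inl (.inl (.inl i)))) = b (.inl (.inl (.inl i))))
    (hPB : ∀ i, P (b (.inl (.inl (.inr i)))) = b (.inl (.inl (.inr i))))
    (hPC : ∀ i, P (b (.inl (.inr i))) = 0)
    (hP0 : ∀ i, P (b (.inr (i, 0))) = b (.inr (i, 0)))
    (hP1 : ∀ i, P (b (.inr (i, 1))) = 0)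
    (hQA : ∀ i, Q (b (.inl (.inl (.inl i)))) = b (.inl (.inl (.inl i))))
    (hQB : ∀ i, Q (b (.inl (.inl (.inr i)))) = 0)
    (hQC : ∀ i, Q (b (.inl (.inr i))) = b (.inl (.inr i)))
    (hQ0 : ∀ i, Q (b (.inr (i, 0))) = ((Real.cos (t i) : ℂ) ^ 2) • (b (.inr (i, 0)) : H) +
      ((Real.cos (t i) : ℂ) * (Real.sin (t i) : ℂ)) • (b (.inr (i, 1)) : H))
    (hQ1 : ∀ i, Q (b (.inr (i, 1))) =
      ((Real.cos (t i) : ℂ) * (Real.sin (t i) : ℂ)) • (b (.inr (i, 0)) : H) +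
      ((Real.sin (t i) : ℂ) ^ 2) • (b (.inr (i, 1)) : H)) :
    ∃ (m p q d : ℕ) (θ : Fin d → ℝ), (∀ j, 0 < θ j ∧ θ j < Real.pi / 2) ∧
    ∃ b : OrthonormalBasis (Fin (m + p + q + ∑ _j : Fin d, 2)) ℂ Z,
      matOf b P =
        dsum (dsum (dsum (1 : Mat m) (1 : Mat p)) (0 : Mat q))
          (bdiag (fun _ => 2) fun _ => !![1, 0; 0, 0]) ∧
      matOf b Q =
        dsum (dsum (dsum (1 : Mat m) (0 : Mat p)) (1 : Mat q))
          (bdiag (fun _ => 2) fun j =>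
            !![(Real.cos (θ j) : ℂ) ^ 2, (Real.cos (θ j) : ℂ) * (Real.sin (θ j) : ℂ);
               (Real.cos (θ j) : ℂ) * (Real.sin (θ j) : ℂ), (Real.sin (θ j) : ℂ) ^ 2]) := by
  classical
  have hne : ∀ (a b : ℕ) (i : Fin a) (j : Fin b), Fin.castAdd b i ≠ Fin.natAdd a j := by
    intro a b i j h
    have := congrArg Fin.val h
    simp at this
    omega
  obtain ⟨e, he⟩ := bdiag_two_eq (Fintype.card D)
  let eA := Fintype.equivFin A
  let eB := Fintype.equivFin B
  let eC := Fintype.equivFin C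
  let eD := Fintype.equivFin D
  let E : (((A ⊕ B) ⊕ C) ⊕ (D × Fin 2)) ≃
      Fin (Fintype.card A + Fintype.card B + Fintype.card C + ∑ _j : Fin (Fintype.card D), 2) :=
    (Equiv.sumCongr ((Equiv.sumCongr ((Equiv.sumCongr eA eB).trans finSumFinEquiv) eC).trans
      finSumFinEquiv) ((Equiv.prodCongr eD (Equiv.refl _)).trans e)).trans finSumFinEquiv
  have hb : ∀ i j, inner ℂ (b i : H) (b j : H) = if i = j then (1 : ℂ) else 0 := by
    intro i j
    have := orthonormal_iff_ite.1 b.orthonormal i j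
    simpa using this
  refine ⟨_, _, _, _, fun j => t (eD.symm j), fun j => ht _, b.reindex E, ?_, ?_⟩
  · ext i j
    obtain ⟨i, rfl⟩ := E.surjective i
    obtain ⟨j, rfl⟩ := E.surjective j
    simp only [matOf, Matrix.of_apply, OrthonormalBasis.reindex_apply, Equiv.symm_apply_apply]
    rcases i with ((i | i) | i) | ⟨i, k⟩ <;> rcases j with ((j | j) | j) | ⟨j, l⟩ <;>
      (try fin_cases k) <;> (try fin_cases l) <;>
      simp [hPA, hPB, hPC, hP0, hP1, hb, E, dsum, blks, he, Matrix.one_apply, hne, (hne _ _ _ _).symm]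
  · ext i j
    obtain ⟨i, rfl⟩ := E.surjective i
    obtain ⟨j, rfl⟩ := E.surjective j
    simp only [matOf, Matrix.of_apply, OrthonormalBasis.reindex_apply, Equiv.symm_apply_apply]
    rcases i with ((i | i) | i) | ⟨i, k⟩ <;> rcases j with ((j | j) | j) | ⟨j, l⟩ <;>
      (try fin_cases k) <;> (try fin_cases l) <;>
      simp [hQA, hQB, hQC, hQ0, hQ1, hb, E, dsum, blks, he, Matrix.one_apply, hne, (hne _ _ _ _).symm,
        inner_add_right, inner_smul_right] <;> (split_ifs with h <;> simp [h])

theorem angle_exists (l : ℝ) (h0 : 0 < l) (h1 : l < 1) :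
    ∃ t : ℝ, (0 < t ∧ t < Real.pi / 2) ∧ Real.cos t ^ 2 = l ∧ 0 < Real.cos t ∧ 0 < Real.sin t := by
  have hs : 0 < √l := Real.sqrt_pos.2 h0
  have hs1 : √l < 1 := by rw [Real.sqrt_lt' one_pos]; simpa using h1
  have ht : 0 < Real.arccos √l ∧ Real.arccos √l < Real.pi / 2 :=
    ⟨Real.arccos_pos.2 hs1, Real.arccos_lt_pi_div_two.2 hs⟩
  have hc : Real.cos (Real.arccos √l) = √l := Real.cos_arccos (by linarith) hs1.le
  refine ⟨_, ht, ?_, ?_, ?_⟩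
  · rw [hc, Real.sq_sqrt h0.le]
  · rwa [hc]
  · exact Real.sin_pos_of_pos_of_lt_pi ht.1 (by linarith [Real.pi_pos, ht.2])

theorem Pj_eq {H : Type*} [NormedAddCommGroup H] [InnerProductSpace ℂ H]
    (X : Submodule ℂ H) [h : FiniteDimensional ℂ X] : Pj X = X.starProjection := by
  unfold Pj
  rw [dif_pos h]
  rfl

theorem core_eig {H : Type*} [NormedAddCommGroup H] [InnerProductSpace ℂ H]
    (X Y : Submodule ℂ H) [FiniteDimensional ℂ X] [FiniteDimensional ℂ Y] :
    ∃ (n : ℕ) (u : OrthonormalBasis (Fin n) ℂ X) (l : Fin n → ℝ),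
      ∀ i, X.starProjection (Y.starProjection (u i : H)) = (l i : ℂ) • (u i : H) := by
  let T : X →ₗ[ℂ] X :=
    (X.orthogonalProjectionOnto ∘L Y.starProjection ∘L X.subtypeL : X →L[ℂ] X)
  have hTa : ∀ x : X, ((T x : X) : H) = X.starProjection (Y.starProjection (x : H)) := fun x => rfl
  have hT : T.IsSymmetric := by
    intro x y
    rw [Submodule.coe_inner, Submodule.coe_inner, hTa, hTa,
      Submodule.inner_starProjection_left_eq_right, Submodule.starProjection_mem_subspace_eq_self,
      Submodule.inner_starProjection_left_eq_right, ← Submodule.inner_starProjection_left_eq_right X,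
      Submodule.starProjection_mem_subspace_eq_self]
  refine ⟨_, hT.eigenvectorBasis rfl, hT.eigenvalues rfl, fun i => ?_⟩
  rw [← hTa, hT.apply_eigenvectorBasis]
  simp

set_option maxHeartbeats 2000000 in
/-- Proposition `halmd`, Halmos' two projections theorem. -/
theorem stmt19 {H : Type*} [NormedAddCommGroup H] [InnerProductSpace ℂ H] [CompleteSpace H]
    (X Y : Submodule ℂ H) [FiniteDimensional ℂ X] [FiniteDimensional ℂ Y] :
    ∃ (m p q d : ℕ) (θ : Fin d → ℝ), (∀ j, 0 < θ j ∧ θ j < Real.pi / 2) ∧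
    ∃ b : OrthonormalBasis (Fin (m + p + q + ∑ _j : Fin d, 2)) ℂ ↥(X ⊔ Y),
      matOf b (Pj X) =
        dsum (dsum (dsum (1 : Mat m) (1 : Mat p)) (0 : Mat q))
          (bdiag (fun _ => 2) fun _ => !![1, 0; 0, 0]) ∧
      matOf b (Pj Y) =
        dsum (dsum (dsum (1 : Mat m) (0 : Mat p)) (1 : Mat q))
          (bdiag (fun _ => 2) fun j =>
            !![(Real.cos (θ j) : ℂ) ^ 2, (Real.cos (θ j) : ℂ) * (Real.sin (θ j) : ℂ);
               (Real.cos (θ j) : ℂ) * (Real.sin (θ j) : ℂ), (Real.sin (θ j) : ℂ) ^ 2]) := by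
  classical
  rw [Pj_eq, Pj_eq]
  obtain ⟨n, u, l, hPQ⟩ := core_eig X Y
  set P := X.starProjection with hP
  set Q := Y.starProjection with hQ
  have hPs : ∀ x y, inner ℂ (P x) y = inner ℂ x (P y) :=
    Submodule.inner_starProjection_left_eq_right X
  have hQs : ∀ x y, inner ℂ (Q x) y = inner ℂ x (Q y) :=
    Submodule.inner_starProjection_left_eq_right Y
  have hPX : ∀ x ∈ X, P x = x := fun x hx => Submodule.starProjection_eq_self_iff.2 hx
  have hQY : ∀ x ∈ Y, Q x = x := fun x hx => Submodule.starProjection_eq_self_iff.2 hx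
  have hQm : ∀ x, Q x ∈ Y := Submodule.starProjection_apply_mem Y
  have hQQ : ∀ x, Q (Q x) = Q x := fun x => hQY _ (hQm x)
  have hPu : ∀ i, P (u i : H) = u i := fun i => hPX _ (u i).2
  have huu : ∀ i j, inner ℂ (u i : H) (u j : H) = if i = j then (1 : ℂ) else 0 := by
    intro i j
    simpa using orthonormal_iff_ite.1 u.orthonormal i j
  have hun : ∀ i, ‖(u i : H)‖ = 1 := fun i => u.orthonormal.1 i
  have huQ : ∀ i j, inner ℂ (u i : H) (Q (u j : H)) = if i = j then (l j : ℂ) else 0 := by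
    intro i j
    rw [← hPu i, hPs, hPQ, inner_smul_right, huu]
    simp
  have hQu : ∀ i j, inner ℂ (Q (u i : H)) (u j : H) = if i = j then (l j : ℂ) else 0 := by
    intro i j
    rw [hQs, huQ]
  have hQuQ : ∀ i j, inner ℂ (Q (u i : H)) (Q (u j : H)) = if i = j then (l j : ℂ) else 0 := by
    intro i j
    rw [hQs, hQQ, huQ]
  have hl : ∀ i, l i = ‖Q (u i : H)‖ ^ 2 := by
    intro i
    have h := hQuQ i i
    rw [inner_self_eq_norm_sq_to_K, if_pos rfl] at h
    have h' : ((l i : ℝ) : ℂ) = ((‖Q (u i : H)‖ ^ 2 : ℝ) : ℂ) := by rw [← h]; push_cast; rfl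
    exact Complex.ofReal_injective h'
  have hl0 : ∀ i, 0 ≤ l i := fun i => by rw [hl]; positivity
  have hl1 : ∀ i, l i ≤ 1 := fun i => by
    have := Submodule.norm_starProjection_apply_le Y (u i : H)
    rw [hun] at this
    rw [hl]
    exact pow_le_one₀ (norm_nonneg _) this
  have hA : ∀ i, l i = 1 → Q (u i : H) = u i := by
    intro i hi
    have : Q (u i : H) - u i = 0 := by
      rw [← inner_self_eq_zero (𝕜 := ℂ)]
      rw [inner_sub_left, inner_sub_right, inner_sub_right, hQuQ, huQ, hQu, huu, hi]; simp
    exact sub_eq_zero.1 this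
  have hB : ∀ i, l i = 0 → Q (u i : H) = 0 := by
    intro i hi
    rw [← inner_self_eq_zero (𝕜 := ℂ)]
    rw [hQuQ, hi]; simp
  have hD : ∀ i : {i // l i ≠ 0 ∧ l i ≠ 1}, ∃ t : ℝ, (0 < t ∧ t < Real.pi / 2) ∧
      Real.cos t ^ 2 = l i ∧ 0 < Real.cos t ∧ 0 < Real.sin t := fun i =>
    angle_exists _ (lt_of_le_of_ne (hl0 _) i.2.1.symm) (lt_of_le_of_ne (hl1 _) i.2.2)
  choose t ht htl htc hts using hD
  let c : {i // l i ≠ 0 ∧ l i ≠ 1} → ℂ := fun i => (Real.cos (t i) : ℂ)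
  let s : {i // l i ≠ 0 ∧ l i ≠ 1} → ℂ := fun i => (Real.sin (t i) : ℂ)
  have hc0 : ∀ i, c i ≠ 0 := fun i => Complex.ofReal_ne_zero.2 (htc i).ne'
  have hs0 : ∀ i, s i ≠ 0 := fun i => Complex.ofReal_ne_zero.2 (hts i).ne'
  have hcs : ∀ i, s i ^ 2 = 1 - c i ^ 2 := fun i => by
    have := Real.sin_sq (t i)
    simp only [s, c]
    exact_mod_cast this
  have hcl : ∀ i : {i // l i ≠ 0 ∧ l i ≠ 1}, (l i : ℂ) = c i ^ 2 := fun i => by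
    simp only [c]
    exact_mod_cast (htl i).symm
  have hcc : ∀ i, (starRingEnd ℂ) (c i) = c i := fun i => Complex.conj_ofReal _
  have hss : ∀ i, (starRingEnd ℂ) (s i) = s i := fun i => Complex.conj_ofReal _
  let v : {i // l i ≠ 0 ∧ l i ≠ 1} → H := fun i =>
    (c i * s i)⁻¹ • (Q (u i : H) - (c i ^ 2) • (u i : H))
  have hQuv : ∀ i : {i // l i ≠ 0 ∧ l i ≠ 1},
      Q (u i : H) = (c i ^ 2) • (u i : H) + (c i * s i) • v i := by
    intro i
    simp only [v]
    rw [smul_smul, mul_inv_cancel₀ (mul_ne_zero (hc0 i) (hs0 i)), one_smul]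
    abel
  have hPv : ∀ i, P (v i) = 0 := by
    intro i
    simp only [v, map_smul, map_sub, hPQ, hPu, hcl, sub_self, smul_zero]
  have hQv : ∀ i, Q (v i) = (c i * s i) • (u i : H) + (s i ^ 2) • v i := by
    intro i
    have h1 : Q (v i) = ((c i * s i)⁻¹ * s i ^ 2) • Q (u i : H) := by
      rw [hcs]
      simp only [v, map_smul, map_sub, hQQ, mul_smul, sub_smul, one_smul]
    rw [h1, hQuv, smul_add, smul_smul, smul_smul]
    congr 2 <;> field_simp [hc0 i, hs0 i]
  have hXv : ∀ x ∈ X, ∀ i, inner ℂ x (v i) = 0 := by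
    intro x hx i
    rw [← hPX x hx, hPs, hPv, inner_zero_right]
  have huv : ∀ i j, inner ℂ (u i : H) (v j) = 0 := fun i j => hXv _ (u i).2 j
  have hvu : ∀ i j, inner ℂ (v j) (u i : H) = 0 := fun i j => inner_eq_zero_symm.1 (huv i j)
  have hvv : ∀ i j, inner ℂ (v i) (v j) = if i = j then (1 : ℂ) else 0 := by
    intro i j
    have h1 : inner ℂ (v i) (v j) = (c i * s i)⁻¹ * inner ℂ (Q (u i : H)) (v j) := by
      conv_lhs => rw [show v i = (c i * s i)⁻¹ • (Q (u i : H) - (c i ^ 2) • (u i : H)) from rfl]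
      rw [inner_smul_left, inner_sub_left, inner_smul_left, huv]
      simp [hcc, hss]
    have h2 : inner ℂ (Q (u i : H)) (v j) = if i = j then c i * s i else 0 := by
      rw [hQs, hQv, inner_add_right, inner_smul_right, inner_smul_right, huv, huu]
      by_cases h : i = j
      · simp [h]
      · simp [h, Subtype.coe_injective.eq_iff]
    rw [h1, h2]
    split_ifs with h
    · exact inv_mul_cancel₀ (mul_ne_zero (hc0 i) (hs0 i))
    · simp
  have huZ : ∀ i, (u i : H) ∈ X ⊔ Y := fun i => Submodule.mem_sup_left (u i).2
  have hvZ : ∀ i, v i ∈ X ⊔ Y := fun i =>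
    Submodule.smul_mem _ _ (Submodule.sub_mem _ (Submodule.mem_sup_right (hQm _))
      (Submodule.smul_mem _ _ (huZ _)))
  let W : Submodule ℂ H := (X ⊔ Y) ⊓ (Xᗮ ⊓ (Submodule.span ℂ (Set.range v))ᗮ)
  have : FiniteDimensional ℂ W := Submodule.finiteDimensional_of_le (inf_le_left : W ≤ X ⊔ Y)
  have hWX : ∀ w ∈ W, ∀ x ∈ X, inner ℂ x w = 0 := fun w hw x hx =>
    (Submodule.mem_orthogonal _ _).1 hw.2.1 x hx
  have hWv : ∀ w ∈ W, ∀ i, inner ℂ (v i) w = 0 := fun w hw i =>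
    (Submodule.mem_orthogonal _ _).1 hw.2.2 _ (Submodule.subset_span ⟨i, rfl⟩)
  have hWu : ∀ w ∈ W, ∀ i, inner ℂ (u i : H) w = 0 := fun w hw i => hWX w hw _ (u i).2
  -- vectors orthogonal to all `u i` are orthogonal to `X`
  have hXu : ∀ z : H, (∀ i, inner ℂ (u i : H) z = 0) → ∀ x ∈ X, inner ℂ x z = 0 := by
    intro z hz x hx
    have h := u.sum_repr ⟨x, hx⟩
    have h' := congrArg (fun y : X => (y : H)) h
    simp only [Submodule.coe_sum, Submodule.coe_smul] at h'
    rw [← h', sum_inner]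
    exact Finset.sum_eq_zero fun i _ => by rw [inner_smul_left, hz, mul_zero]
  have hPW : ∀ w ∈ W, P w = 0 := fun w hw =>
    (Submodule.starProjection_apply_eq_zero_iff X).2 hw.2.1
  have hQW : ∀ w ∈ W, Q w = w := by
    intro w hw
    have h1 : ∀ i, inner ℂ (u i : H) (Q w) = 0 := by
      intro i
      rw [← hQs]
      by_cases h0 : l i = 0
      · rw [hB i h0, inner_zero_left]
      by_cases h1 : l i = 1
      · rw [hA i h1, hWu w hw]
      · rw [hQuv ⟨i, h0, h1⟩, inner_add_left, inner_smul_left, inner_smul_left, hWu w hw,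
          hWv w hw]
        simp
    have hz : w - Q w ∈ X ⊔ Y := Submodule.sub_mem _ hw.1 (Submodule.mem_sup_right (hQm _))
    have hX : ∀ x ∈ X, inner ℂ x (w - Q w) = 0 := by
      intro x hx
      rw [inner_sub_right, hWX w hw x hx, hXu _ h1 x hx, sub_zero]
    have hY : ∀ y ∈ Y, inner ℂ y (w - Q w) = 0 := by
      intro y hy
      rw [← hQY y hy, hQs, map_sub, hQQ, sub_self, inner_zero_right]
    obtain ⟨x, hx, y, hy, hxy⟩ := Submodule.mem_sup.1 hz
    have : inner ℂ (w - Q w) (w - Q w) = 0 := by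
      nth_rewrite 1 [← hxy]
      rw [inner_add_left, hX x hx, hY y hy, add_zero]
    exact (sub_eq_zero.1 (inner_self_eq_zero.1 this)).symm
  let w := stdOrthonormalBasis ℂ W
  have hww : ∀ i j, inner ℂ (w i : H) (w j : H) = if i = j then (1 : ℂ) else 0 := by
    intro i j
    simpa using orthonormal_iff_ite.1 w.orthonormal i j
  have huw : ∀ i j, inner ℂ (u i : H) (w j : H) = 0 := fun i j => hWu _ (w j).2 i
  have hwu : ∀ i j, inner ℂ (w j : H) (u i : H) = 0 := fun i j => inner_eq_zero_symm.1 (huw i j)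
  have hvw : ∀ i j, inner ℂ (v i : H) (w j : H) = 0 := fun i j => hWv _ (w j).2 i
  have hwv : ∀ i j, inner ℂ (w j : H) (v i : H) = 0 := fun i j => inner_eq_zero_symm.1 (hvw i j)
  let f : ((({i // l i = 1} ⊕ {i // l i = 0}) ⊕ Fin (Module.finrank ℂ W)) ⊕
      ({i // l i ≠ 0 ∧ l i ≠ 1} × Fin 2)) → ↥(X ⊔ Y) := fun z => match z with
    | .inl (.inl (.inl i)) => ⟨u i, huZ _⟩
    | .inl (.inl (.inr i)) => ⟨u i, huZ _⟩
    | .inl (.inr i) => ⟨w i, (w i).2.1⟩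
    | .inr (i, 0) => ⟨u i, huZ _⟩
    | .inr (i, 1) => ⟨v i, hvZ i⟩
  have hf : Orthonormal ℂ f := by
    rw [orthonormal_iff_ite]
    rintro (((⟨i, hi⟩ | ⟨i, hi⟩) | i) | ⟨⟨i, hi⟩, k⟩) (((⟨j, hj⟩ | ⟨j, hj⟩) | j) | ⟨⟨j, hj⟩, m⟩) <;>
      (try fin_cases k) <;> (try fin_cases m) <;>
      simp [f, huu, hww, huw, hwu, huv, hvu, hvw, hwv, hvv] <;>
      
      (rintro rfl; first
        | exact absurd (hi.symm.trans hj) (by norm_num)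
        | exact hj.1 hi | exact hj.2 hi | exact hi.1 hj | exact hi.2 hj)
  have hsp : (Submodule.span ℂ (Set.range f))ᗮ = ⊥ := by
    rw [Submodule.eq_bot_iff]
    intro z hz
    have hz' : ∀ k, inner ℂ (f k : H) (z : H) = 0 := fun k =>
      (Submodule.mem_orthogonal _ _).1 hz _ (Submodule.subset_span ⟨k, rfl⟩)
    have hzu : ∀ i, inner ℂ (u i : H) (z : H) = 0 := by
      intro i
      by_cases h0 : l i = 0
      · exact hz' (.inl (.inl (.inr ⟨i, h0⟩)))
      by_cases h1 : l i = 1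
      · exact hz' (.inl (.inl (.inl ⟨i, h1⟩)))
      · exact hz' (.inr (⟨i, h0, h1⟩, 0))
    have hzW : (z : H) ∈ W := by
      refine ⟨z.2, (Submodule.mem_orthogonal _ _).2 (hXu _ hzu), ?_⟩
      have hle : Submodule.span ℂ (Set.range v) ≤ (Submodule.span ℂ {(z : H)})ᗮ := by
        rw [Submodule.span_le]
        rintro _ ⟨i, rfl⟩
        rw [SetLike.mem_coe, Submodule.mem_orthogonal_singleton_iff_inner_left]
        exact hz' (.inr (i, 1))
      exact (Submodule.mem_orthogonal _ _).2 fun y hy =>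
        Submodule.mem_orthogonal_singleton_iff_inner_left.1 (hle hy)
    have : (⟨z, hzW⟩ : W) = 0 := by
      refine InnerProductSpace.ext_inner_left_basis w.toBasis ?_
      intro i
      rw [inner_zero_right, OrthonormalBasis.coe_toBasis]
      exact hz' (.inl (.inr i))
    exact Subtype.ext (congrArg (fun y : W => (y : H)) this)
  let b := OrthonormalBasis.mkOfOrthogonalEqBot hf hsp
  have hb : ∀ k, b k = f k := fun k => by simp [b]
  refine assemble P Q t ht b ?_ ?_ ?_ ?_ ?_ ?_ ?_ ?_ ?_ ?_ <;> intro i <;> simp only [hb]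
  · exact hPu _
  · exact hPu _
  · exact hPW _ (w i).2
  · exact hPu _
  · exact hPv _
  · exact hA _ i.2
  · exact hB _ i.2
  · exact hQW _ (w i).2
  · exact hQuv i
  · exact hQv i
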